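/- arXiv:2605.01581 — 2 statements merged into one kernel-verified Lean document; each statement's English description precedes it below -/
import Mathlib

section
/- Loewner upper bound of the posterior covariance by the prior covariance (Lemma 2, first bound): for Σ an n×n real symmetric positive semidefinite matrix and α, σ > 0, the matrix σ²·Σ·(α²·Σ + σ²·I)⁻¹ is positive semidefinite and satisfies σ²·Σ·(α²·Σ + σ²·I)⁻¹ ⪯ Σ in the Loewner order, i.e. Σ − σ²·Σ·(α²·Σ + σ²·I)⁻¹ is positive semidefinite. -/
open Matrix

/-- **Loewner upper bound of the posterior covariance by the prior covariance**
(Lemma 2, first bound): for `V` an `n × n` real symmetric positive semidefinite matrix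
and `α, σ > 0`, the matrix `σ² • (V * (α² • V + σ² • 1)⁻¹)` is positive semidefinite and
satisfies `σ² • (V * (α² • V + σ² • 1)⁻¹) ⪯ V` in the Loewner order, i.e.
`V - σ² • (V * (α² • V + σ² • 1)⁻¹)` is positive semidefinite. -/
theorem posterior_covariance_le_prior
    (n : ℕ) (hn : 0 < n)
    (V : Matrix (Fin n) (Fin n) ℝ) (hV : V.PosSemidef)
    (α σ : ℝ) (hα : 0 < α) (hσ : 0 < σ)
    (A : Matrix (Fin n) (Fin n) ℝ)
    (hA : A = α ^ 2 • V + σ ^ 2 • (1 : Matrix (Fin n) (Fin n) ℝ)) :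
    (σ ^ 2 • (V * A⁻¹)).PosSemidef ∧ (V - σ ^ 2 • (V * A⁻¹)).PosSemidef := by
  have hσ2 : 0 < σ ^ 2 := by positivity
  have hα2 : 0 < α ^ 2 := by positivity
  have hApd : A.PosDef := by
    rw [hA]
    exact Matrix.PosDef.posSemidef_add (hV.smul hα2.le) (Matrix.PosDef.one.smul hσ2)
  have hdet : IsUnit A.det := (Matrix.isUnit_iff_isUnit_det A).1 hApd.isUnit
  have hVA : V * A = A * V := by
    rw [hA]; simp [mul_add, add_mul]
  have hBA : A⁻¹ * A = 1 := Matrix.nonsing_inv_mul A hdet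
  have hAB : A * A⁻¹ = 1 := Matrix.mul_nonsing_inv A hdet
  have hB : A⁻¹.PosSemidef := hApd.posSemidef.inv
  have hcomm : V * A⁻¹ = A⁻¹ * V := by
    calc V * A⁻¹ = A⁻¹ * A * V * A⁻¹ := by rw [hBA, one_mul]
      _ = A⁻¹ * (A * V) * A⁻¹ := by simp only [mul_assoc]
      _ = A⁻¹ * V * (A * A⁻¹) := by rw [← hVA]; simp only [mul_assoc]
      _ = A⁻¹ * V := by rw [hAB, mul_one]
  constructor
  · have h1 : V * A⁻¹ = A⁻¹ᴴ * (α ^ 2 • (Vᴴ * V) + σ ^ 2 • V) * A⁻¹ := by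
      have h2 : α ^ 2 • (Vᴴ * V) + σ ^ 2 • V = A * V := by
        rw [hV.isHermitian.eq, hA]; simp [add_mul]
      rw [h2, hB.isHermitian.eq, ← mul_assoc A⁻¹, hBA, one_mul]
    rw [h1]
    exact (((((Matrix.posSemidef_conjTranspose_mul_self V).smul hα2.le).add
      (hV.smul hσ2.le)).conjTranspose_mul_mul_same A⁻¹)).smul hσ2.le
  · have h1 : V - σ ^ 2 • (V * A⁻¹) = α ^ 2 • (Vᴴ * A⁻¹ * V) := by
      have h2 : V = α ^ 2 • (V * V * A⁻¹) + σ ^ 2 • (V * A⁻¹) := by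
        calc V = V * A * A⁻¹ := by rw [mul_assoc, hAB, mul_one]
          _ = _ := by
            rw [show V * A = α ^ 2 • (V * V) + σ ^ 2 • V by rw [hA]; simp [mul_add]]
            simp [add_mul]
      rw [hV.isHermitian.eq, mul_assoc V A⁻¹ V, ← hcomm, ← mul_assoc]
      exact sub_eq_of_eq_add h2
    rw [h1]
    exact (hB.conjTranspose_mul_mul_same V).smul hα2.le
end

section
/- Total trace bound (matrix form of the total error bound in Theorem 1): for Σ an n×n real symmetric positive semidefinite matrix, α, σ > 0, P_L the diagonal projection onto the first m coordinates, P_H = I − P_L, and η ≥ 0 with Tr(P_H·Σ) ≤ η·Tr(Σ), one has Tr(σ²·Σ·(α²·Σ + σ²·I)⁻¹) ≤ m·(σ²/α²) + η·Tr(Σ). -/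
open Matrix

/-- **Total trace bound** (matrix form of the total error bound in Theorem 1): for `V`
an `n × n` real symmetric positive semidefinite matrix, `α, σ > 0`, `P_L` the diagonal
projection onto the first `m` coordinates, `P_H = 1 - P_L`, and `η ≥ 0` with
`Tr(P_H * V) ≤ η * Tr(V)`, one has
`Tr(σ² • (V * (α² • V + σ² • 1)⁻¹)) ≤ m * (σ² / α²) + η * Tr(V)`. -/
theorem total_trace_bound
    (n : ℕ) (hn : 0 < n)
    (V : Matrix (Fin n) (Fin n) ℝ) (hV : V.PosSemidef)
    (α σ : ℝ) (hα : 0 < α) (hσ : 0 < σ)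
    (A : Matrix (Fin n) (Fin n) ℝ)
    (hA : A = α ^ 2 • V + σ ^ 2 • (1 : Matrix (Fin n) (Fin n) ℝ))
    (m : ℕ) (hm : m ≤ n)
    (PL PH : Matrix (Fin n) (Fin n) ℝ)
    (hPL : PL = Matrix.diagonal fun i : Fin n => if (i : ℕ) < m then (1 : ℝ) else 0)
    (hPH : PH = 1 - PL)
    (η : ℝ) (hη : 0 ≤ η) (hηV : (PH * V).trace ≤ η * V.trace) :
    (σ ^ 2 • (V * A⁻¹)).trace ≤ (m : ℝ) * (σ ^ 2 / α ^ 2) + η * V.trace := by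
  have hApd : A.PosDef := by
    rw [hA]
    exact Matrix.PosDef.posSemidef_add (hV.smul (by positivity))
      (Matrix.PosDef.one.smul (by positivity))
  have hdet : IsUnit A.det := (Matrix.isUnit_iff_isUnit_det A).mp hApd.isUnit
  have hB : (A⁻¹).PosSemidef := hApd.inv.posSemidef
  have h1 : A * A⁻¹ = 1 := Matrix.mul_nonsing_inv A hdet
  have h2 : A⁻¹ * A = 1 := Matrix.nonsing_inv_mul A hdet
  generalize A⁻¹ = B at *
  have hVBV : (V * B * V).PosSemidef := by
    have h := hB.conjTranspose_mul_mul_same V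
    rwa [hV.isHermitian.eq] at h
  have e1 : α ^ 2 • (V * B) + σ ^ 2 • B = 1 := by
    rw [← h1, hA]; simp [add_mul]
  have e2 : α ^ 2 • (V * B * V) + σ ^ 2 • (V * B) = V := by
    have : V * (B * A) = V := by rw [h2, mul_one]
    rw [hA] at this
    simpa [mul_add, mul_assoc] using this
  have key : ∀ i : Fin n, σ ^ 2 * (V * B) i i ≤
      (if (i : ℕ) < m then σ ^ 2 / α ^ 2 else 0) + (PH * V) i i := by
    intro i
    have d1 := congrFun (congrFun e1 i) i
    have d2 := congrFun (congrFun e2 i) i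
    simp only [Matrix.add_apply, Matrix.smul_apply, smul_eq_mul, Matrix.one_apply_eq] at d1 d2
    have p1 : 0 ≤ B i i := hB.diag_nonneg
    have p2 : 0 ≤ (V * B * V) i i := hVBV.diag_nonneg
    have hP : (PH * V) i i = if (i : ℕ) < m then 0 else V i i := by
      rw [hPH, hPL, sub_mul, Matrix.sub_apply, one_mul, Matrix.diagonal_mul]
      split_ifs <;> simp
    rw [hP]
    split_ifs
    · rw [add_zero, le_div_iff₀ (by positivity)]
      have : 0 ≤ σ ^ 2 * B i i := by positivity
      nlinarith [sq_nonneg σ]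
    · have : 0 ≤ α ^ 2 * (V * B * V) i i := by positivity
      linarith
  have hsum := Finset.sum_le_sum fun i (_ : i ∈ Finset.univ) => key i
  rw [Finset.sum_add_distrib] at hsum
  have hcount : ∑ i : Fin n, (if (i : ℕ) < m then σ ^ 2 / α ^ 2 else 0)
      = (m : ℝ) * (σ ^ 2 / α ^ 2) := by
    rw [Fin.sum_univ_eq_sum_range (fun i => if i < m then σ ^ 2 / α ^ 2 else 0) n,
      ← Finset.sum_filter]
    have : (Finset.range n).filter (· < m) = Finset.range m := by
      ext x; simp; omega
    rw [this]; simp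
  rw [hcount] at hsum
  have ht : (σ ^ 2 • (V * B)).trace = ∑ i, σ ^ 2 * (V * B) i i := by
    simp [Matrix.trace]
  have ht2 : (PH * V).trace = ∑ i, (PH * V) i i := rfl
  rw [ht]
  linarith
end
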